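/- If a graphic instance of capacitated k-supplier with outliers satisfies L(u) ≤ deg_G(u) for every u ∈ ℱ and admits a distance-1 solution, then there exists a set S ⊆ ℱ that is a skeleton. -/

import Mathlib

open Finset

open scoped Classical

/-- A graphic instance of capacitated `k`-supplier with outliers: a finite bipartite
graph `G` with client vertices `Cs`, facility vertices `Fs` (partitioning the vertex set),
and edges only between the two parts. -/
def IsGraphicInstance {V : Type*} [Fintype V] (G : SimpleGraph V)
    (Cs Fs : Finset V) : Prop :=
  Disjoint Cs Fs ∧ Cs ∪ Fs = Finset.univ ∧
    ∀ u v, G.Adj u v → (u ∈ Cs ∧ v ∈ Fs) ∨ (u ∈ Fs ∧ v ∈ Cs)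

/-- A distance-`τ` solution `(C, F, φ)` of a graphic instance. -/
def IsSolution {V : Type*} [Fintype V] [DecidableEq V] (G : SimpleGraph V)
    (Cs Fs : Finset V) (L : V → ℕ) (k p τ : ℕ)
    (C F : Finset V) (φ : V → V) : Prop :=
  C ⊆ Cs ∧ F ⊆ Fs ∧ C.card = p ∧ F.card = k ∧
    (∀ v ∈ C, φ v ∈ F) ∧
    (∀ u ∈ F, (C.filter (fun v => φ v = u)).card ≤ L u) ∧
    (∀ v ∈ C, G.edist v (φ v) ≤ (τ : ℕ∞))

/-- A preskeleton: a subset of facilities satisfying the separation and injection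
properties with respect to some distance-1 solution. -/
def IsPreskeleton {V : Type*} [Fintype V] [DecidableEq V] (G : SimpleGraph V)
    (Cs Fs : Finset V) (L : V → ℕ) (k p : ℕ) (S : Finset V) : Prop :=
  S ⊆ Fs ∧
    (∀ u ∈ S, ∀ u' ∈ S, u ≠ u' → 6 ≤ G.edist u u') ∧
    ∃ C F φ, IsSolution G Cs Fs L k p 1 C F φ ∧
      ∃ f : V → V, Set.InjOn f ↑S ∧ ∀ u ∈ S, f u ∈ F ∧ G.edist u (f u) ≤ 2

/-- A skeleton: a preskeleton whose witnessing distance-1 solution moreover satisfies the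
covering property. -/
def IsSkeleton {V : Type*} [Fintype V] [DecidableEq V] (G : SimpleGraph V)
    (Cs Fs : Finset V) (L : V → ℕ) (k p : ℕ) (S : Finset V) : Prop :=
  S ⊆ Fs ∧
    (∀ u ∈ S, ∀ u' ∈ S, u ≠ u' → 6 ≤ G.edist u u') ∧
    ∃ C F φ, IsSolution G Cs Fs L k p 1 C F φ ∧
      (∀ u ∈ F, ∃ s ∈ S, G.edist u s ≤ 4) ∧
      ∃ f : V → V, Set.InjOn f ↑S ∧ ∀ u ∈ S, f u ∈ F ∧ G.edist u (f u) ≤ 2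

/-- In a graphic instance, a walk of even length joins two vertices of the same part, and
a walk of odd length joins vertices of different parts. -/
theorem IsGraphicInstance.even_length_iff {V : Type*} [Fintype V] {G : SimpleGraph V}
    {Cs Fs : Finset V} (hinst : IsGraphicInstance G Cs Fs) {u v : V} (w : G.Walk u v) :
    Even w.length ↔ (u ∈ Fs ↔ v ∈ Fs) := by
  induction w with
  | nil => simp
  | cons h w ih =>
    obtain ⟨hdisj, -, hadj⟩ := hinst
    rw [Finset.disjoint_left] at hdisj
    rw [SimpleGraph.Walk.length_cons, Nat.even_add_one, ih]
    rcases hadj _ _ h with ⟨h₁, h₂⟩ | ⟨h₁, h₂⟩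
    · have := hdisj h₁
      tauto
    · have := hdisj h₂
      tauto

/-- Two facilities of a graphic instance at distance more than `4` are at distance at
least `6`. -/
theorem IsGraphicInstance.six_le_edist {V : Type*} [Fintype V] {G : SimpleGraph V}
    {Cs Fs : Finset V} (hinst : IsGraphicInstance G Cs Fs) {u v : V} (hu : u ∈ Fs)
    (hv : v ∈ Fs) (h : 4 < G.edist u v) : 6 ≤ G.edist u v := by
  by_cases htop : G.edist u v = ⊤
  · simp [htop]
  · obtain ⟨w, hw⟩ := SimpleGraph.exists_walk_of_edist_ne_top htop
    obtain ⟨m, hm⟩ := (hinst.even_length_iff w).2 (iff_of_true hu hv)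
    rw [← hw] at h ⊢
    have h4 : 4 < w.length := by exact_mod_cast h
    have h6 : 6 ≤ w.length := by omega
    exact_mod_cast h6

/-- A preskeleton which is maximal under inclusion is a skeleton. -/
theorem IsPreskeleton.isSkeleton_of_maximal {V : Type*} [Fintype V] [DecidableEq V]
    {G : SimpleGraph V} {Cs Fs : Finset V} {L : V → ℕ} {k p : ℕ} {S : Finset V}
    (hinst : IsGraphicInstance G Cs Fs)
    (hS : Maximal (IsPreskeleton G Cs Fs L k p) S) : IsSkeleton G Cs Fs L k p S := by
  obtain ⟨hSF, hsep, C, F, φ, hsol, f, hinj, hf⟩ := hS.prop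
  refine ⟨hSF, hsep, C, F, φ, hsol, fun u hu => ?_, f, hinj, hf⟩
  by_contra! hfar
  have huF : u ∈ Fs := hsol.2.1 hu
  have hsix : ∀ s ∈ S, 6 ≤ G.edist u s := fun s hs =>
    hinst.six_le_edist huF (hSF hs) (hfar s hs)
  have huS : u ∉ S := fun h => by simpa using hfar u h
  have hfu : ∀ s ∈ S, f s ≠ u := by
    rintro s hs rfl
    have h := (hfar s hs).trans_le (SimpleGraph.edist_comm.trans_le (hf s hs).2)
    exact absurd h (by decide)
  have hupd : ∀ s ∈ S, Function.update f u u s = f s := fun s hs =>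
    Function.update_of_ne (ne_of_mem_of_not_mem hs huS) _ _
  refine huS (hS.le_of_ge (y := insert u S) ⟨?_, ?_, C, F, φ, hsol,
    Function.update f u u, ?_, ?_⟩ (Finset.subset_insert u S) (Finset.mem_insert_self u S))
  · exact Finset.insert_subset huF hSF
  · intro a ha b hb hab
    rw [Finset.mem_insert] at ha hb
    rcases ha with rfl | ha <;> rcases hb with rfl | hb
    · exact absurd rfl hab
    · exact hsix b hb
    · exact SimpleGraph.edist_comm (G := G) ▸ hsix a ha
    · exact hsep a ha b hb hab
  · rw [Finset.coe_insert, Set.injOn_insert (by simpa using huS)]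
    refine ⟨hinj.congr fun s hs => (hupd s hs).symm, ?_⟩
    rintro ⟨s, hs, h⟩
    rw [hupd s hs, Function.update_self] at h
    exact hfu s hs h
  · intro a ha
    rcases Finset.mem_insert.1 ha with rfl | ha
    · simpa using hu
    · rw [hupd a ha]
      exact hf a ha

/-- If `L(u) ≤ deg(u)` for every facility and the graphic instance admits a
distance-1 solution, then a skeleton exists. -/
theorem skeleton_exists {V : Type*} [Fintype V] [DecidableEq V]
    (G : SimpleGraph V) [DecidableRel G.Adj] (Cs Fs : Finset V) (L : V → ℕ) (k p : ℕ)
    (hinst : IsGraphicInstance G Cs Fs)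
    (hdeg : ∀ u ∈ Fs, L u ≤ G.degree u)
    (hsol : ∃ C F φ, IsSolution G Cs Fs L k p 1 C F φ) :
    ∃ S : Finset V, S ⊆ Fs ∧ IsSkeleton G Cs Fs L k p S := by
  obtain ⟨C, F, φ, hsol⟩ := hsol
  have hempty : IsPreskeleton G Cs Fs L k p ∅ :=
    ⟨by simp, by simp, C, F, φ, hsol, id, by simp, by simp⟩
  obtain ⟨S, -, hS⟩ := (Set.toFinite {S | IsPreskeleton G Cs Fs L k p S}).exists_le_maximal hempty
  exact ⟨S, hS.prop.1, IsPreskeleton.isSkeleton_of_maximal hinst hS⟩
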